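/- Fix a fuzziness parameter t > 1, a number of clusters c ≥ 1, and positive distances d : Fin c → ℝ (dⱼ > 0 for all j). Consider the fuzzy c-means per-point objective f(μ) = Σⱼ μⱼᵗ · dⱼ² over membership vectors μ : Fin c → ℝ with μⱼ ≥ 0 for all j and Σⱼ μⱼ = 1 (real exponentiation μⱼᵗ). Then f attains its minimum over this simplex at μ*ⱼ = dⱼ^{−2/(t−1)} / Σₖ dₖ^{−2/(t−1)}; that is, for every admissible μ, f(μ) ≥ f(μ*). -/

import Mathlib

/-- For fuzziness `t > 1`, `c ≥ 1` clusters and positive distances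
`d : Fin c → ℝ`, the fuzzy c-means per-point objective `f(μ) = Σⱼ μⱼᵗ·dⱼ²` over
the simplex `{μ : μⱼ ≥ 0, Σⱼ μⱼ = 1}` attains its minimum at
`μ*ⱼ = dⱼ^{−2/(t−1)} / Σₖ dₖ^{−2/(t−1)}`: for every admissible `μ`,
`f(μ) ≥ f(μ*)`. -/
theorem fcm_membership_update_optimal
    (t : ℝ) (ht : 1 < t) (c : ℕ) (hc : 1 ≤ c)
    (d : Fin c → ℝ) (hd : ∀ j, 0 < d j)
    (μstar : Fin c → ℝ)
    (hμstar : ∀ j, μstar j =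
      d j ^ (-2 / (t - 1)) / ∑ k, d k ^ (-2 / (t - 1)))
    (μ : Fin c → ℝ) (hμ : ∀ j, 0 ≤ μ j) (hsum : ∑ j, μ j = 1) :
    ∑ j, μ j ^ t * d j ^ 2 ≥ ∑ j, μstar j ^ t * d j ^ 2 := by
  have ht0 : 0 < t - 1 := by linarith
  set S := ∑ k, d k ^ (-2 / (t - 1)) with hS
  have hSpos : 0 < S := by
    apply Finset.sum_pos (fun k _ => Real.rpow_pos_of_pos (hd k) _)
    exact ⟨⟨0, hc⟩, Finset.mem_univ _⟩
  have hm : ∀ j, 0 < μstar j := fun j => by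
    rw [hμstar j]
    exact div_pos (Real.rpow_pos_of_pos (hd j) _) hSpos
  have hmsum : ∑ j, μstar j = 1 := by
    simp_rw [hμstar]
    rw [← Finset.sum_div, ← hS, div_self hSpos.ne']
  set K := (S ^ (t - 1))⁻¹ with hK
  have hKpos : 0 < K := inv_pos.mpr (Real.rpow_pos_of_pos hSpos _)
  have key : ∀ j, μstar j ^ t * d j ^ 2 = K * μstar j := fun j => by
    have h1 : μstar j ^ t = μstar j ^ (t - 1) * μstar j := by
      rw [← Real.rpow_add_one (hm j).ne', sub_add_cancel]
    have h2 : μstar j ^ (t - 1) = (d j ^ 2)⁻¹ * K := by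
      rw [hμstar j, Real.div_rpow (Real.rpow_pos_of_pos (hd j) _).le hSpos.le,
        ← Real.rpow_mul (hd j).le, div_mul_cancel₀ _ ht0.ne', Real.rpow_neg (hd j).le,
        Real.rpow_two, div_eq_mul_inv]
    have h3 : d j ≠ 0 := (hd j).ne'
    rw [h1, h2]
    field_simp
  have bound : ∀ j, K * (μstar j + t * (μ j - μstar j)) ≤ μ j ^ t * d j ^ 2 := fun j => by
    have hb := one_add_mul_self_le_rpow_one_add (s := μ j / μstar j - 1)
      (by have := div_nonneg (hμ j) (hm j).le; linarith) ht.le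
    rw [add_sub_cancel, Real.div_rpow (hμ j) (hm j).le,
      le_div_iff₀ (Real.rpow_pos_of_pos (hm j) _)] at hb
    calc K * (μstar j + t * (μ j - μstar j))
        = (1 + t * (μ j / μstar j - 1)) * (K * μstar j) := by
          have := (hm j).ne'
          field_simp
      _ = (1 + t * (μ j / μstar j - 1)) * μstar j ^ t * d j ^ 2 := by
          rw [← key j, mul_assoc]
      _ ≤ _ := mul_le_mul_of_nonneg_right hb (sq_nonneg _)
  calc ∑ j, μstar j ^ t * d j ^ 2 = ∑ j, K * (μstar j + t * (μ j - μstar j)) := by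
        simp_rw [key]
        rw [← Finset.mul_sum, ← Finset.mul_sum, Finset.sum_add_distrib, ← Finset.mul_sum,
          Finset.sum_sub_distrib, hsum, hmsum]
        ring
    _ ≤ _ := Finset.sum_le_sum fun j _ => bound j
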